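/- Fix ε>0 and set K=(1/8−ε)N, R=N/4, Q=N/8. For all sufficiently large N, if λ ∈ F₂(x)/F₂[x] has denominator of degree ≤ (1+ε)K + O_ε(log N), then |β^trunc(λ) − β(λ)| ≤ (1/5)·2^{−K}. -/

import Mathlib

open Polynomial
open scoped Classical

noncomputable section

abbrev F2 := ZMod 2
abbrev Kinf := LaurentSeries F2
def polyToK (f : F2[X]) : Kinf :=
  ∑ i ∈ f.support, HahnSeries.single (-(i : ℤ)) (f.coeff i)
def ordK (a : Kinf) : WithBot ℤ := if a = 0 then ⊥ else (↑(-a.order) : WithBot ℤ)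
def eKr (a : Kinf) : ℝ := (-1 : ℝ) ^ ((a.coeff 1).val)
def eK (a : Kinf) : ℂ := ((eKr a : ℝ) : ℂ)
def InT (θ : Kinf) : Prop := ordK θ ≤ ((-1 : ℤ) : WithBot ℤ)
def GN (N : ℕ) : Finset F2[X] :=
  Set.Finite.toFinset (s := {f : F2[X] | f.degree < (N : ℕ)}) (by
    have h : {f : F2[X] | f.degree < (N : ℕ)} = ↑(Polynomial.degreeLT F2 N) := by
      ext f
      simp [Polynomial.mem_degreeLT]
    rw [h]
    have : Finite (Polynomial.degreeLT F2 N) :=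
      Finite.of_equiv _ (Polynomial.degreeLTEquiv F2 N).symm.toEquiv
    exact (Polynomial.degreeLT F2 N : Set F2[X]).toFinite)
def ratK (u s : F2[X]) : Kinf := polyToK u * (polyToK s)⁻¹

/-- τ(f): the number of divisors of `f`. -/
def tau (f : F2[X]) : ℕ := ((GN (f.natDegree + 1)).filter (fun g => g ∣ f)).card

/-- φ(f): the number of invertible residues modulo `f`. -/
def phi (f : F2[X]) : ℕ := ((GN f.natDegree).filter (fun g => IsCoprime g f)).card

/-- ω(f): the number of (irreducible nonconstant, i.e. prime) divisors of `f`. -/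
def omegaP (f : F2[X]) : ℕ :=
  ((GN (f.natDegree + 1)).filter (fun r => Irreducible r ∧ r ∣ f)).card

/-- The Möbius function on `F₂[x]`. -/
def mu (f : F2[X]) : ℤ := if Squarefree f then (-1) ^ (omegaP f) else 0

/-- The set of invertible residues modulo `s` (canonical representatives of
`(F₂[x]/(s))^×`, i.e. polynomials of degree `< deg s` coprime to `s`). -/
def residues (s : F2[X]) : Finset F2[X] := (GN s.natDegree).filter (fun t => IsCoprime t s)

/-- `α(s) = μ(s)/φ(s)`. -/
def alphaA (s : F2[X]) : ℝ := (mu s : ℝ) / (phi s : ℝ)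

/-- `α'(s) = ∏_{r | s prime} 3/(2^{deg r}+3)` for `s` squarefree, `0` otherwise. -/
def alphaB (s : F2[X]) : ℝ :=
  if Squarefree s then
    ∏ r ∈ (GN (s.natDegree + 1)).filter (fun r => Irreducible r ∧ r ∣ s),
      (3 : ℝ) / ((2 : ℝ) ^ r.natDegree + 3)
  else 0

/-- `Λ_M(f) = Σ_{s ∈ G_M} α(s) Σ_{t ∈ (F₂[x]/(s))^×} e(f t s⁻¹)`. -/
def LambdaM (M : ℕ) (f : F2[X]) : ℝ :=
  ∑ s ∈ GN M, alphaA s * ∑ t ∈ residues s, eKr (polyToK f * ratK t s)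

/-- `H_M(f) = Σ_{s ∈ G_M} α'(s) Σ_{t ∈ (F₂[x]/(s))^×} e(f t s⁻¹)`. -/
def HM (M : ℕ) (f : F2[X]) : ℝ :=
  ∑ s ∈ GN M, alphaB s * ∑ t ∈ residues s, eKr (polyToK f * ratK t s)

/-- `Λ'(f) = deg f` if `f` is prime, `0` otherwise. -/
def LambdaP (f : F2[X]) : ℝ := if Irreducible f then (f.natDegree : ℝ) else 0

/-- `Ψ(f) = Λ'(f+1) H_Q(f) 1_{f ∈ G_N}`. -/
def Psi (N Q : ℕ) (f : F2[X]) : ℝ :=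
  LambdaP (f + 1) * HM Q f * (if f ∈ GN N then 1 else 0)

/-- `Ψ'(f) = Λ_R(f+1) H_Q(f) 1_{f ∈ G_N}`. -/
def Psi' (N R Q : ℕ) (f : F2[X]) : ℝ :=
  LambdaM R (f + 1) * HM Q f * (if f ∈ GN N then 1 else 0)

/-- `Λ_r(f)` for a single prime `r`. -/
def Lambda_r (r f : F2[X]) : ℝ :=
  if r ∣ f then 0 else (2 : ℝ) ^ r.natDegree / ((2 : ℝ) ^ r.natDegree - 1)

/-- `τ²_r(f)` for a single prime `r`. -/
def tauSq_r (r f : F2[X]) : ℝ :=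
  if r ∣ f then 4 * (2 : ℝ) ^ r.natDegree / ((2 : ℝ) ^ r.natDegree + 3)
  else (2 : ℝ) ^ r.natDegree / ((2 : ℝ) ^ r.natDegree + 3)

/-- `˜Λ_M(f) = ∏_{r ∈ G_M prime} Λ_r(f)`. -/
def LambdaTilde (M : ℕ) (f : F2[X]) : ℝ :=
  ∏ r ∈ (GN M).filter (fun r => Irreducible r), Lambda_r r f

/-- `˜H_M(f) = ∏_{r ∈ G_M prime} τ²_r(f)`. -/
def HTilde (M : ℕ) (f : F2[X]) : ℝ :=
  ∏ r ∈ (GN M).filter (fun r => Irreducible r), tauSq_r r f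

/-- The element of `K∞` determined by a rational function (with `x ↦ t⁻¹`). -/
def ratToK (l : RatFunc F2) : Kinf := polyToK l.num * (polyToK l.denom)⁻¹

/-- `c : F₂(x)/F₂[x] → ℝ` (encoded on the canonical representatives
`λ = num/denom` in lowest terms with `deg num < deg denom`) is the system of Fourier
coefficients of `F : F₂[x] → ℝ`, i.e. `F(f) = Σ_λ c(λ) e(λ f)`. -/
def IsFourierCoeffs (F : F2[X] → ℝ) (c : RatFunc F2 → ℝ) : Prop :=
  (Function.support c).Finite ∧
  (∀ l : RatFunc F2, c l ≠ 0 → (l.num).degree < (l.denom).degree) ∧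
  ∀ f : F2[X], F f = ∑ᶠ l : RatFunc F2, c l * eKr (ratToK l * polyToK f)

/-- The canonical representative (mod `F₂[x]`) of a rational function. -/
def fracRat (l : RatFunc F2) : RatFunc F2 :=
  l - algebraMap F2[X] (RatFunc F2) (l.num / l.denom)

/-- `c(n, η)` from the statement of the exponential sum estimate for `Λ'`. -/
def cFun (n : ℕ) (η : Kinf) : ℝ :=
  if ordK η < ((-(n : ℤ) - 1 : ℤ) : WithBot ℤ) then 1
  else if ordK η = ((-(n : ℤ) - 1 : ℤ) : WithBot ℤ) then -1
  else 0

/-- The class `C_B(X)` (with explicit implied constant `Cst`): functions whose Fourier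
coefficients are supported on `λ` with squarefree denominator of degree `≤ X` and satisfy
`|c(λ)| ≤ Cst · τ(denom λ)^B / 2^{deg (denom λ)}`. -/
def InClassC (B X : ℕ) (Cst : ℝ) (F : F2[X] → ℝ) : Prop :=
  ∃ c : RatFunc F2 → ℝ, IsFourierCoeffs F c ∧
    (∀ l : RatFunc F2, c l ≠ 0 → Squarefree l.denom ∧ (l.denom).natDegree ≤ X) ∧
    (∀ l : RatFunc F2, |c l| ≤ Cst * (tau l.denom : ℝ) ^ B / 2 ^ (l.denom).natDegree)

/-- The fractional part `‖θ‖` of `θ ∈ K∞`: keep exactly the coefficients of `x^{-n}`, `n ≥ 1`. -/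
def fracK (θ : Kinf) : Kinf :=
  ⟨fun n => if 1 ≤ n then θ.coeff n else 0, by
    apply θ.isPWO_support'.mono
    intro n hn
    simp only [Function.mem_support, ne_eq] at hn ⊢
    intro h
    apply hn
    split_ifs
    · exact h
    · rfl⟩

/-! ### The additive character -/

lemma s14_polyToK_coeff (f : F2[X]) (n : ℤ) :
    (polyToK f).coeff n = if n ≤ 0 then f.coeff (-n).toNat else 0 := by
  unfold polyToK
  rw [HahnSeries.coeff_sum]
  simp only [HahnSeries.coeff_single]
  split_ifs with hn
  · rw [Finset.sum_eq_single (-n).toNat]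
    · rw [if_pos (by omega)]
    · intro b _ hb
      rw [if_neg (by omega)]
    · intro h
      rw [if_pos (by omega)]
      simpa using h
  · apply Finset.sum_eq_zero
    intro i _
    rw [if_neg (by omega)]

def s14_pK : F2[X] →+* Kinf :=
  Polynomial.eval₂RingHom HahnSeries.C (HahnSeries.single (-1 : ℤ) (1 : F2))

lemma s14_pK_apply (f : F2[X]) : s14_pK f = polyToK f := by
  unfold s14_pK polyToK
  rw [Polynomial.coe_eval₂RingHom, Polynomial.eval₂_eq_sum, Polynomial.sum_def]
  apply Finset.sum_congr rfl
  intro i _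
  rw [HahnSeries.single_pow, HahnSeries.C_apply, HahnSeries.single_mul_single]
  simp

lemma s14_pK_inj : Function.Injective s14_pK := by
  intro f g h
  rw [s14_pK_apply, s14_pK_apply] at h
  ext i
  have := congrArg (fun a : Kinf => a.coeff (-(i : ℤ))) h
  simpa [s14_polyToK_coeff] using this

def s14_io : RatFunc F2 →+* Kinf := IsFractionRing.lift s14_pK_inj

lemma s14_io_poly (f : F2[X]) : s14_io (algebraMap F2[X] (RatFunc F2) f) = polyToK f := by
  unfold s14_io
  rw [IsFractionRing.lift_algebraMap, s14_pK_apply]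

lemma s14_io_ratToK (l : RatFunc F2) : ratToK l = s14_io l := by
  conv_rhs => rw [← RatFunc.num_div_denom l]
  rw [map_div₀, s14_io_poly, s14_io_poly, ratToK, div_eq_mul_inv]

/-- the additive character on rational functions -/
def s14_E (l : RatFunc F2) : ℝ := eKr (s14_io l)

lemma s14_E_add (a b : RatFunc F2) : s14_E (a + b) = s14_E a * s14_E b := by
  unfold s14_E eKr
  rw [map_add, HahnSeries.coeff_add]
  rw [ZMod.val_add, ← neg_one_pow_eq_pow_mod_two, pow_add]

lemma s14_E_zero : s14_E 0 = 1 := by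
  simp [s14_E, eKr]

lemma s14_E_poly (f : F2[X]) : s14_E (algebraMap F2[X] (RatFunc F2) f) = 1 := by
  unfold s14_E eKr
  rw [s14_io_poly, s14_polyToK_coeff]
  simp

lemma s14_E_cases (l : RatFunc F2) : s14_E l = 1 ∨ s14_E l = -1 := by
  unfold s14_E eKr
  exact neg_one_pow_eq_or ℝ _

lemma s14_E_abs (l : RatFunc F2) : |s14_E l| = 1 := by
  rcases s14_E_cases l with h | h <;> simp [h]

lemma s14_E_sum {α : Type*} (s : Finset α) (g : α → RatFunc F2) :
    s14_E (∑ i ∈ s, g i) = ∏ i ∈ s, s14_E (g i) := by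
  induction s using Finset.induction_on with
  | empty => simp [s14_E_zero]
  | insert a s ha ih => rw [Finset.sum_insert ha, Finset.prod_insert ha, s14_E_add, ih]

/-- proper fractions -/
def s14_Proper (l : RatFunc F2) : Prop :=
  ∃ a q : F2[X], q ≠ 0 ∧ a.degree < q.degree ∧
    l * algebraMap F2[X] (RatFunc F2) q = algebraMap F2[X] (RatFunc F2) a

lemma s14_Proper_zero : s14_Proper 0 := ⟨0, 1, one_ne_zero, by simp, by simp⟩

lemma s14_Proper_add {a b : RatFunc F2} (ha : s14_Proper a) (hb : s14_Proper b) :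
    s14_Proper (a + b) := by
  obtain ⟨u, q, hq, hd, h⟩ := ha
  obtain ⟨v, r, hr, he, k⟩ := hb
  refine ⟨u * r + v * q, q * r, mul_ne_zero hq hr, ?_, ?_⟩
  · apply lt_of_le_of_lt (degree_add_le _ _)
    apply max_lt
    · rw [degree_mul, degree_mul]
      exact WithBot.add_lt_add_right (by simpa using hr) hd
    · rw [degree_mul, degree_mul, add_comm]
      exact WithBot.add_lt_add_left (by simpa using hq) he
  · simp only [map_add, map_mul]
    rw [← h, ← k]; ring

lemma s14_Proper_neg {a : RatFunc F2} (ha : s14_Proper a) : s14_Proper (-a) := by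
  obtain ⟨u, q, hq, hd, h⟩ := ha
  exact ⟨-u, q, hq, by simpa using hd, by simp [← h]⟩

lemma s14_Proper_sum {α : Type*} (s : Finset α) (g : α → RatFunc F2)
    (h : ∀ i ∈ s, s14_Proper (g i)) : s14_Proper (∑ i ∈ s, g i) := by
  induction s using Finset.induction_on with
  | empty => simpa using s14_Proper_zero
  | insert a s ha ih =>
    rw [Finset.sum_insert ha]
    exact s14_Proper_add (h a (by simp)) (ih fun i hi => h i (by simp [hi]))

lemma s14_Proper_div {a q : F2[X]} (hq : q ≠ 0) (h : a.degree < q.degree) :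
    s14_Proper (algebraMap F2[X] (RatFunc F2) a / algebraMap F2[X] (RatFunc F2) q) := by
  refine ⟨a, q, hq, h, ?_⟩
  rw [div_mul_cancel₀]
  simpa using hq

lemma s14_Proper_of_num {l : RatFunc F2} (h : l.num.degree < l.denom.degree) :
    s14_Proper l := by
  rw [← RatFunc.num_div_denom l]
  exact s14_Proper_div l.denom_ne_zero h

/-- If the character is trivial on all multiples of a rational function then it is a polynomial
(in the sense that its proper part vanishes). -/
lemma s14_trivial_proper {l : RatFunc F2} (hl : s14_Proper l)
    (h : ∀ f : F2[X], s14_E (l * algebraMap F2[X] (RatFunc F2) f) = 1) : l = 0 := by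
  obtain ⟨a, q, hq, hd, hh⟩ := hl
  have hco : ∀ n : ℤ, 1 ≤ n → (s14_io l).coeff n = 0 := by
    intro n hn
    have h1 := h (X ^ (n - 1).toNat)
    unfold s14_E eKr at h1
    rw [map_mul, s14_io_poly] at h1
    have h2 : polyToK (X ^ (n - 1).toNat) = HahnSeries.single (1 - n) (1 : F2) := by
      ext m
      rw [s14_polyToK_coeff, HahnSeries.coeff_single]
      rw [coeff_X_pow]
      split_ifs <;> first | rfl | omega
    rw [h2] at h1
    have h3 : (s14_io l * HahnSeries.single (1 - n) (1 : F2)).coeff 1 = (s14_io l).coeff n := by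
      have := HahnSeries.coeff_mul_single_add (r := (1 : F2)) (x := s14_io l) (a := n) (b := 1 - n)
      simpa using this
    rw [h3] at h1
    revert h1
    generalize (s14_io l).coeff n = x
    fin_cases x
    · intro _; rfl
    · intro h1
      exfalso
      revert h1
      simp [ZMod.val]
      norm_num
  -- polynomial part
  by_contra hne
  have hneK : s14_io l ≠ 0 := by simpa using hne
  set m := (s14_io l).order with hm
  have hm0 : (s14_io l).coeff m ≠ 0 := by
    rw [hm]; exact HahnSeries.coeff_order_eq_zero.not.mpr hneK
  have hm1 : m ≤ 0 := by
    by_contra hc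
    exact hm0 (hco m (by omega))
  have hord : ∀ f : F2[X], f ≠ 0 → (polyToK f).order = -(f.natDegree : ℤ) := by
    intro f hf
    have hc : (polyToK f).coeff (-(f.natDegree : ℤ)) ≠ 0 := by
      rw [s14_polyToK_coeff]
      simpa using hf
    apply le_antisymm
    · exact HahnSeries.order_le_of_coeff_ne_zero hc
    · by_contra hlt
      push Not at hlt
      have hz : polyToK f ≠ 0 := by
        intro h0; rw [h0] at hc; simp at hc
      have := HahnSeries.coeff_order_eq_zero.not.mpr hz
      apply this
      rw [s14_polyToK_coeff, if_pos (by omega)]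
      apply coeff_eq_zero_of_natDegree_lt
      omega
  have hh2 := congrArg s14_io hh
  rw [map_mul, s14_io_poly, s14_io_poly] at hh2
  have hqK : polyToK q ≠ 0 := by
    rw [← s14_pK_apply]; simpa using (map_ne_zero_iff s14_pK s14_pK_inj).mpr hq
  have ha : a ≠ 0 := by
    rintro rfl
    rw [← s14_pK_apply 0, map_zero] at hh2
    exact (mul_ne_zero hneK hqK) hh2
  have h5 := congrArg HahnSeries.order hh2
  rw [HahnSeries.order_mul hneK hqK, hord q hq, hord a ha] at h5
  have h6 : a.natDegree < q.natDegree := natDegree_lt_natDegree ha hd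
  omega

/-- character as monoid hom -/
def s14_char (l : RatFunc F2) : Multiplicative F2[X] →* ℝ where
  toFun f := s14_E (l * algebraMap F2[X] (RatFunc F2) f.toAdd)
  map_one' := by simp [s14_E_zero]
  map_mul' a b := by
    rw [toAdd_mul, map_add, mul_add, s14_E_add]

lemma s14_char_inj {a b : RatFunc F2} (ha : s14_Proper a) (hb : s14_Proper b)
    (h : s14_char a = s14_char b) : a = b := by
  have : a + -b = 0 := by
    apply s14_trivial_proper (s14_Proper_add ha (s14_Proper_neg hb))
    intro f
    have h1 : s14_E (a * algebraMap F2[X] (RatFunc F2) f)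
        = s14_E (b * algebraMap F2[X] (RatFunc F2) f) :=
      DFunLike.congr_fun h (Multiplicative.ofAdd f)
    rw [add_mul, s14_E_add, h1, ← s14_E_add, ← add_mul]
    simp [s14_E_zero]
  rw [← sub_eq_add_neg] at this
  exact sub_eq_zero.mp this

lemma s14_indep (s : Finset (RatFunc F2)) (hs : ∀ l ∈ s, s14_Proper l) (c : RatFunc F2 → ℝ)
    (h : ∀ f : F2[X], ∑ l ∈ s, c l * s14_E (l * algebraMap F2[X] (RatFunc F2) f) = 0) :
    ∀ l ∈ s, c l = 0 := by
  have hli := linearIndependent_monoidHom (Multiplicative F2[X]) ℝ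
  have hinj : Function.Injective (fun l : s => s14_char l.1) := by
    intro a b hab
    exact Subtype.ext (s14_char_inj (hs _ a.2) (hs _ b.2) hab)
  have hli2 := hli.comp _ hinj
  rw [Fintype.linearIndependent_iff] at hli2
  intro l hl
  refine hli2 (fun l => c l.1) ?_ ⟨l, hl⟩
  ext f
  have := h f.toAdd
  rw [← Finset.sum_coe_sort] at this
  simpa [Finset.sum_apply, s14_char] using this

/-! ### Ramanujan sums -/

lemma s14_mem_GN {N : ℕ} {f : F2[X]} : f ∈ GN N ↔ f.degree < (N : ℕ) := by
  simp [GN]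

/-- the fraction `t / s` -/
def s14_q (t s : F2[X]) : RatFunc F2 :=
  algebraMap F2[X] (RatFunc F2) t / algebraMap F2[X] (RatFunc F2) s


lemma s14_AM_ne {s : F2[X]} (h : s ≠ 0) : algebraMap F2[X] (RatFunc F2) s ≠ 0 := by simpa using h

lemma s14_eKr_eq (f t s : F2[X]) :
    eKr (polyToK f * ratK t s) = s14_E (s14_q t s * algebraMap F2[X] (RatFunc F2) f) := by
  unfold s14_E s14_q ratK
  rw [map_mul, map_div₀, s14_io_poly, s14_io_poly, s14_io_poly, mul_comm, div_eq_mul_inv]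

/-- the Ramanujan sum -/
def s14_C (s f : F2[X]) : ℝ := ∑ t ∈ residues s, s14_E (s14_q t s * algebraMap F2[X] (RatFunc F2) f)

lemma s14_mem_residues {s t : F2[X]} (hs : s ≠ 0) :
    t ∈ residues s ↔ t.degree < s.degree ∧ IsCoprime t s := by
  unfold residues
  rw [Finset.mem_filter, s14_mem_GN, degree_eq_natDegree hs]

lemma s14_C_one (f : F2[X]) : s14_C 1 f = 1 := by
  unfold s14_C
  have : residues (1 : F2[X]) = {0} := by
    ext t
    rw [s14_mem_residues one_ne_zero]
    simp only [degree_one, Finset.mem_singleton]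
    constructor
    · rintro ⟨h, _⟩
      by_contra hc
      exact absurd (zero_le_degree_iff.mpr hc) (not_le.mpr h)
    · rintro rfl
      exact ⟨by simp, isCoprime_one_right⟩
  rw [this]
  simp [s14_q, s14_E_zero]

lemma s14_C_mul {a b : F2[X]} (ha : a ≠ 0) (hb : b ≠ 0) (hab : IsCoprime a b) (f : F2[X]) :
    s14_C (a * b) f = s14_C a f * s14_C b f := by
  unfold s14_C
  rw [Finset.sum_mul_sum, ← Finset.sum_product']
  symm
  have hab0 : a * b ≠ 0 := mul_ne_zero ha hb
  refine Finset.sum_bij (fun p _ => p.1 * b + p.2 * a) ?_ ?_ ?_ ?_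
  · rintro ⟨u, v⟩ hp
    rw [Finset.mem_product, s14_mem_residues ha, s14_mem_residues hb] at hp
    obtain ⟨⟨hu, hu'⟩, hv, hv'⟩ := hp
    dsimp only at *
    rw [s14_mem_residues hab0]
    constructor
    · apply lt_of_le_of_lt (degree_add_le _ _)
      apply max_lt
      · rw [degree_mul, degree_mul]
        exact WithBot.add_lt_add_right (by simpa using hb) hu
      · rw [degree_mul, degree_mul, add_comm]
        exact WithBot.add_lt_add_left (by simpa using ha) hv
    · apply IsCoprime.mul_right
      · rw [IsCoprime.add_mul_right_left_iff]
        exact hu'.mul_left hab.symm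
      · rw [add_comm, IsCoprime.add_mul_right_left_iff]
        exact hv'.mul_left hab
  · rintro ⟨u, v⟩ hp ⟨u', v'⟩ hp' h
    rw [Finset.mem_product, s14_mem_residues ha, s14_mem_residues hb] at hp hp'
    obtain ⟨⟨hu, -⟩, hv, -⟩ := hp
    obtain ⟨⟨hu', -⟩, hv', -⟩ := hp'
    dsimp only at *
    have h1 : a ∣ (u - u') * b := ⟨v' - v, by linear_combination h⟩
    have h2 : a ∣ u - u' := hab.dvd_of_dvd_mul_right h1
    have h3 : u - u' = 0 := by
      apply eq_zero_of_dvd_of_degree_lt h2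
      exact lt_of_le_of_lt (degree_sub_le _ _) (max_lt hu hu')
    have h4 : b ∣ (v - v') * a := ⟨u' - u, by linear_combination h⟩
    have h5 : b ∣ v - v' := hab.symm.dvd_of_dvd_mul_right h4
    have h6 : v - v' = 0 := by
      apply eq_zero_of_dvd_of_degree_lt h5
      exact lt_of_le_of_lt (degree_sub_le _ _) (max_lt hv hv')
    rw [sub_eq_zero.mp h3, sub_eq_zero.mp h6]
  · intro t ht
    rw [s14_mem_residues hab0] at ht
    obtain ⟨htd, htc⟩ := ht
    obtain ⟨x, y, hxy⟩ := hab
    -- t = t*x*a + t*y*b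
    set u := (t * y) % a with hu
    have hdu : u.degree < a.degree := EuclideanDomain.mod_lt _ ha
    have hdm : a * (t * y / a) + u = t * y := EuclideanDomain.div_add_mod _ _
    set v := t * x + (t * y / a) * b with hv
    have hsum : u * b + v * a = t := by
      linear_combination b * hdm + t * hxy
    have hdv : v.degree < b.degree := by
      have h1 : (v * a).degree < (a * b).degree := by
        have : v * a = t - u * b := by linear_combination hsum
        rw [this]
        apply lt_of_le_of_lt (degree_sub_le _ _)
        apply max_lt htd
        rw [degree_mul, degree_mul]
        exact WithBot.add_lt_add_right (by simpa using hb) hdu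
      rw [degree_mul, degree_mul, add_comm] at h1
      exact lt_of_add_lt_add_left h1
    refine ⟨(u, v), ?_, hsum⟩
    rw [Finset.mem_product, s14_mem_residues ha, s14_mem_residues hb]
    rw [← hsum] at htc
    refine ⟨⟨hdu, ?_⟩, hdv, ?_⟩
    · have h1 := htc.of_mul_right_left
      rw [IsCoprime.add_mul_right_left_iff] at h1
      exact h1.of_mul_left_left
    · have h1 := htc.of_mul_right_right
      rw [add_comm, IsCoprime.add_mul_right_left_iff] at h1
      exact h1.of_mul_left_left
  · rintro ⟨u, v⟩ _
    dsimp only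
    rw [← s14_E_add, ← add_mul]
    congr 2
    unfold s14_q
    rw [map_add, map_mul, map_mul, map_mul]
    have := s14_AM_ne ha
    have := s14_AM_ne hb
    field_simp

lemma s14_GN_card (d : ℕ) : (GN d).card = 2 ^ d := by
  have h1 : (GN d).card = Nat.card (Polynomial.degreeLT F2 d) := by
    unfold GN
    refine (Set.ncard_eq_toFinset_card {f : F2[X] | f.degree < (d : ℕ)} _).symm.trans ?_
    rw [← Nat.card_coe_set_eq]
    apply Nat.card_congr
    apply Equiv.subtypeEquivRight
    intro f
    simp [Polynomial.mem_degreeLT]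
  rw [h1, Nat.card_congr (Polynomial.degreeLTEquiv F2 d).toEquiv]
  simp

/-- the full sum modulo `r` -/
lemma s14_full {r : F2[X]} (hr : r ≠ 0) (f : F2[X]) :
    ∑ t ∈ GN r.natDegree, s14_E (s14_q t r * algebraMap F2[X] (RatFunc F2) f) =
      if r ∣ f then (2 : ℝ) ^ r.natDegree else 0 := by
  split_ifs with h
  · obtain ⟨g, rfl⟩ := h
    have : ∀ t ∈ GN r.natDegree, s14_E (s14_q t r * algebraMap F2[X] (RatFunc F2) (r * g)) = 1 := by
      intro t _
      rw [← s14_E_poly (t * g)]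
      congr 1
      unfold s14_q
      have := s14_AM_ne hr
      rw [map_mul, map_mul]
      field_simp
    rw [Finset.sum_congr rfl this]
    simp [s14_GN_card]
  · -- find t0 with value -1
    have hex : ∃ t0 ∈ GN r.natDegree, s14_E (s14_q t0 r * algebraMap F2[X] (RatFunc F2) f) = -1 := by
      by_contra hc
      push Not at hc
      have h1 : ∀ t ∈ GN r.natDegree, s14_E (s14_q t r * algebraMap F2[X] (RatFunc F2) f) = 1 := fun t ht =>
        (s14_E_cases _).resolve_right (hc t ht)
      have hprop : s14_Proper (s14_q (f % r) r) :=
        s14_Proper_div hr (EuclideanDomain.mod_lt _ hr)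
      have hdm : r * (f / r) + f % r = f := EuclideanDomain.div_add_mod _ _
      have hz : s14_q (f % r) r = 0 := by
        apply s14_trivial_proper hprop
        intro g
        have hdg : r * (g / r) + g % r = g := EuclideanDomain.div_add_mod _ _
        have h2 := h1 (g % r) (by
          rw [s14_mem_GN, ← degree_eq_natDegree hr]
          exact EuclideanDomain.mod_lt _ hr)
        have h3 : s14_q (f % r) r * algebraMap F2[X] (RatFunc F2) g + algebraMap F2[X] (RatFunc F2) ((f / r) * (g % r)) =
            s14_q (g % r) r * algebraMap F2[X] (RatFunc F2) f + algebraMap F2[X] (RatFunc F2) ((f % r) * (g / r)) := by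
          have hr' := s14_AM_ne hr
          unfold s14_q
          conv_rhs => rw [← hdm]
          conv_lhs => rw [← hdg]
          simp only [map_add, map_mul]
          rw [hdm, hdg]
          field_simp
          ring
        have h4 := congrArg s14_E h3
        rw [s14_E_add, s14_E_add, s14_E_poly, s14_E_poly, h2] at h4
        simpa using h4
      unfold s14_q at hz
      rw [div_eq_zero_iff] at hz
      rcases hz with hz | hz
      · have : f % r = 0 := by simpa using hz
        exact h (EuclideanDomain.mod_eq_zero.mp this)
      · exact s14_AM_ne hr hz
    obtain ⟨t0, ht0, hE⟩ := hex
    have hmem : ∀ t ∈ GN r.natDegree, t + t0 ∈ GN r.natDegree := by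
      intro t ht
      rw [s14_mem_GN] at *
      exact lt_of_le_of_lt (degree_add_le _ _) (max_lt ht ht0)
    have hchar : ∀ t : F2[X], t + t0 + t0 = t := by
      intro t
      rw [add_assoc, CharTwo.add_self_eq_zero, add_zero]
    have hS : ∑ t ∈ GN r.natDegree, s14_E (s14_q t r * algebraMap F2[X] (RatFunc F2) f) =
        ∑ t ∈ GN r.natDegree, -s14_E (s14_q t r * algebraMap F2[X] (RatFunc F2) f) := by
      refine Finset.sum_nbij' (fun t => t + t0) (fun t => t + t0) hmem hmem
        (fun t _ => hchar t) (fun t _ => hchar t) ?_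
      intro t _
      have : s14_q (t + t0) r * algebraMap F2[X] (RatFunc F2) f = s14_q t r * algebraMap F2[X] (RatFunc F2) f + s14_q t0 r * algebraMap F2[X] (RatFunc F2) f := by
        unfold s14_q
        rw [map_add]; ring
      rw [this, s14_E_add, hE]; ring
    rw [Finset.sum_neg_distrib] at hS
    linarith

/-- the value of the Ramanujan sum at a prime -/
def s14_c (r f : F2[X]) : ℝ := (if r ∣ f then (2 : ℝ) ^ r.natDegree else 0) - 1

lemma s14_C_prime {r : F2[X]} (hr : Irreducible r) (f : F2[X]) : s14_C r f = s14_c r f := by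
  unfold s14_c
  rw [← s14_full hr.ne_zero]
  have hres : residues r = (GN r.natDegree).erase 0 := by
    ext t
    unfold residues
    rw [Finset.mem_filter, Finset.mem_erase, and_comm]
    apply and_congr_left
    intro ht
    rw [s14_mem_GN, ← degree_eq_natDegree hr.ne_zero] at ht
    rw [isCoprime_comm, hr.coprime_iff_not_dvd]
    apply not_congr
    constructor
    · intro h
      exact eq_zero_of_dvd_of_degree_lt h ht
    · rintro rfl; exact dvd_zero _
  have h0 : (0 : F2[X]) ∈ GN r.natDegree := by rw [s14_mem_GN]; simp
  unfold s14_C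
  rw [hres, ← Finset.add_sum_erase _ _ h0]
  simp [s14_q, s14_E_zero]

lemma s14_eq_of_associated {a b : F2[X]} (h : Associated a b) : a = b := by
  obtain ⟨u, hu⟩ := h
  obtain ⟨c, hc, hcu⟩ := Polynomial.isUnit_iff.mp u.isUnit
  have : c = 1 := by
    revert hc
    generalize c = x
    fin_cases x
    · intro h; exact absurd h not_isUnit_zero
    · intro _; rfl
  rw [← hcu, this] at hu
  simpa using hu

lemma s14_coprime_irr {a b : F2[X]} (ha : Irreducible a) (hb : Irreducible b) (h : a ≠ b) :
    IsCoprime a b := by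
  rw [ha.coprime_iff_not_dvd]
  intro hd
  exact h (s14_eq_of_associated (ha.associated_of_dvd hb hd))

lemma s14_C_prod (S : Finset F2[X]) (hS : ∀ r ∈ S, Irreducible r) (f : F2[X]) :
    s14_C (∏ r ∈ S, r) f = ∏ r ∈ S, s14_c r f := by
  induction S using Finset.induction_on with
  | empty => simp [s14_C_one]
  | insert a s ha ih =>
    have hS' : ∀ r ∈ s, Irreducible r := fun r hr => hS r (by simp [hr])
    have hia : Irreducible a := hS a (by simp)
    rw [Finset.prod_insert ha, Finset.prod_insert ha, s14_C_mul hia.ne_zero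
      (Finset.prod_ne_zero_iff.mpr fun r hr => (hS' r hr).ne_zero), ih hS', s14_C_prime hia]
    apply IsCoprime.prod_right
    intro r hr
    exact s14_coprime_irr hia (hS' r hr) (by rintro rfl; exact ha hr)

lemma s14_squarefree_prod (S : Finset F2[X]) (hS : ∀ r ∈ S, Irreducible r) :
    Squarefree (∏ r ∈ S, r) := by
  apply Finset.squarefree_prod_of_pairwise_isCoprime
  · intro a ha b hb hab
    exact (s14_coprime_irr (hS a ha) (hS b hb) hab).isRelPrime
  · intro r hr
    exact (hS r hr).squarefree

lemma s14_dvd_prod (S : Finset F2[X]) (hS : ∀ r ∈ S, Irreducible r) {r : F2[X]}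
    (hr : Irreducible r) : r ∣ ∏ r ∈ S, r ↔ r ∈ S := by
  constructor
  · intro h
    obtain ⟨a, ha, hd⟩ := (hr.prime.dvd_finsetProd_iff _).mp h
    rw [s14_eq_of_associated (hr.associated_of_dvd (hS a ha) hd)]
    exact ha
  · intro h
    exact Finset.dvd_prod_of_mem _ h

lemma s14_filter_prod (S : Finset F2[X]) (hS : ∀ r ∈ S, Irreducible r) :
    (GN ((∏ r ∈ S, r).natDegree + 1)).filter (fun r => Irreducible r ∧ r ∣ ∏ r ∈ S, r) = S := by
  have h0 : (∏ r ∈ S, r) ≠ 0 := Finset.prod_ne_zero_iff.mpr fun r hr => (hS r hr).ne_zero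
  ext r
  rw [Finset.mem_filter, s14_mem_GN]
  constructor
  · rintro ⟨_, h1, h2⟩
    exact (s14_dvd_prod S hS h1).mp h2
  · intro h
    have hd := (s14_dvd_prod S hS (hS r h)).mpr h
    refine ⟨?_, hS r h, hd⟩
    have := degree_le_of_dvd hd h0
    rw [degree_eq_natDegree h0] at this
    refine lt_of_le_of_lt this ?_
    exact_mod_cast Nat.lt_succ_self _

lemma s14_squarefree_eq {s : F2[X]} (hs : Squarefree s) :
    ∏ r ∈ UniqueFactorizationMonoid.primeFactors s, r = s := by
  have := UniqueFactorizationMonoid.radical_associated hs.isRadical hs.ne_zero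
  rw [UniqueFactorizationMonoid.radical] at this
  exact s14_eq_of_associated (by simpa using this)

/-- expansion of the truncated sums over sets of primes -/
lemma s14_expand (R M : ℕ) (hMR : M ≤ R) (f : F2[X]) (w : F2[X] → ℝ) (v : F2[X] → ℝ)
    (hw0 : ∀ s, ¬ Squarefree s → w s = 0)
    (hw : ∀ S : Finset F2[X], (∀ r ∈ S, Irreducible r) → w (∏ r ∈ S, r) = ∏ r ∈ S, v r) :
    ∑ s ∈ GN M, w s * ∑ t ∈ residues s, eKr (polyToK f * ratK t s) =
    ∑ S ∈ ((GN R).filter (fun r => Irreducible r)).powerset.filter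
      (fun S => (∑ r ∈ S, r.natDegree) < M), ∏ r ∈ S, (v r * s14_c r f) := by
  simp only [s14_eKr_eq]
  change ∑ s ∈ GN M, w s * s14_C s f = _
  rw [← Finset.sum_filter_of_ne (p := fun s => Squarefree s)]
  swap
  · intro s _ h
    by_contra hc
    rw [hw0 s hc] at h
    simp at h
  symm
  have hP : ∀ S ∈ ((GN R).filter (fun r => Irreducible r)).powerset.filter
      (fun S => (∑ r ∈ S, r.natDegree) < M), ∀ r ∈ S, Irreducible r := by
    intro S hS r hr
    rw [Finset.mem_filter, Finset.mem_powerset] at hS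
    exact (Finset.mem_filter.mp (hS.1 hr)).2
  refine Finset.sum_bij (fun S _ => ∏ r ∈ S, r) ?_ ?_ ?_ ?_
  · intro S hS
    have h1 := hP S hS
    rw [Finset.mem_filter] at hS ⊢
    refine ⟨?_, s14_squarefree_prod S h1⟩
    rw [s14_mem_GN, degree_eq_natDegree (Finset.prod_ne_zero_iff.mpr fun r hr => (h1 r hr).ne_zero),
      natDegree_prod _ _ (fun r hr => (h1 r hr).ne_zero)]
    exact_mod_cast hS.2
  · intro S hS T hT h
    rw [← s14_filter_prod S (hP S hS), ← s14_filter_prod T (hP T hT)]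
    rw [h]
  · intro s hs
    rw [Finset.mem_filter, s14_mem_GN] at hs
    obtain ⟨hd, hsq⟩ := hs
    have heq := s14_squarefree_eq hsq
    have hirr : ∀ r ∈ UniqueFactorizationMonoid.primeFactors s, Irreducible r := by
      intro r hr
      rw [UniqueFactorizationMonoid.mem_primeFactors] at hr
      exact UniqueFactorizationMonoid.irreducible_of_normalized_factor _ hr
    refine ⟨UniqueFactorizationMonoid.primeFactors s, ?_, heq⟩
    rw [Finset.mem_filter, Finset.mem_powerset]
    constructor
    · intro r hr
      rw [Finset.mem_filter, s14_mem_GN]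
      refine ⟨?_, hirr r hr⟩
      have hdv : r ∣ s := by rw [← heq]; exact Finset.dvd_prod_of_mem _ hr
      refine lt_of_le_of_lt (degree_le_of_dvd hdv hsq.ne_zero) (lt_of_lt_of_le hd ?_)
      exact_mod_cast hMR
    · rw [← natDegree_prod _ _ (fun r hr => (hirr r hr).ne_zero), heq]
      rw [degree_eq_natDegree hsq.ne_zero] at hd
      exact_mod_cast hd
  · intro S hS
    rw [hw S (hP S hS), s14_C_prod S (hP S hS), Finset.prod_mul_distrib]

def s14_a (r : F2[X]) : ℝ := -1 / ((2 : ℝ) ^ r.natDegree - 1)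
def s14_b (r : F2[X]) : ℝ := 3 / ((2 : ℝ) ^ r.natDegree + 3)

lemma s14_alphaA (S : Finset F2[X]) (hS : ∀ r ∈ S, Irreducible r) :
    alphaA (∏ r ∈ S, r) = ∏ r ∈ S, s14_a r := by
  unfold alphaA mu omegaP s14_a
  rw [s14_filter_prod S hS, if_pos (s14_squarefree_prod S hS), Finset.prod_div_distrib]
  have h1 : (phi (∏ r ∈ S, r) : ℝ) = s14_C (∏ r ∈ S, r) 0 := by
    unfold s14_C phi residues
    simp [s14_E_zero]
  rw [h1, s14_C_prod S hS]
  simp [s14_c]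

lemma s14_alphaB (S : Finset F2[X]) (hS : ∀ r ∈ S, Irreducible r) :
    alphaB (∏ r ∈ S, r) = ∏ r ∈ S, s14_b r := by
  unfold alphaB
  rw [s14_filter_prod S hS, if_pos (s14_squarefree_prod S hS)]
  rfl

lemma s14_natDegree_pos {r : F2[X]} (hr : Irreducible r) : 1 ≤ r.natDegree :=
  hr.natDegree_pos

lemma s14_Lambda_r {r : F2[X]} (hr : Irreducible r) (f : F2[X]) :
    Lambda_r r f = 1 + s14_a r * s14_c r f := by
  unfold Lambda_r s14_a s14_c
  have h2 : (2 : ℝ) ≤ 2 ^ r.natDegree := by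
    simpa using pow_le_pow_right₀ (by norm_num : (1 : ℝ) ≤ 2) (s14_natDegree_pos hr)
  have h3 : (2 : ℝ) ^ r.natDegree - 1 ≠ 0 := by linarith
  split_ifs <;> field_simp <;> ring

lemma s14_tauSq_r (r f : F2[X]) :
    tauSq_r r f = 1 + s14_b r * s14_c r f := by
  unfold tauSq_r s14_b s14_c
  have h3 : (2 : ℝ) ^ r.natDegree + 3 ≠ 0 := by positivity
  split_ifs <;> field_simp <;> ring

/-! ### Local expansions -/

lemma s14_sum_powerset_ite (P : Finset F2[X]) (f g : F2[X] → ℝ) :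
    ∑ S ∈ P.powerset, ∏ r ∈ P, (if r ∈ S then f r else g r) = ∏ r ∈ P, (f r + g r) := by
  rw [Finset.prod_add]
  apply Finset.sum_congr rfl
  intro S hS
  rw [Finset.mem_powerset] at hS
  rw [Finset.prod_ite]
  congr 1
  · apply Finset.prod_congr _ (fun _ _ => rfl)
    ext r; simp only [Finset.mem_filter]
    exact ⟨fun h => h.2, fun h => ⟨hS h, h⟩⟩
  · apply Finset.prod_congr _ (fun _ _ => rfl)
    ext r; simp

lemma s14_sum_powerset2 (P : Finset F2[X]) (h : F2[X] → Prop → Prop → ℝ) :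
    ∑ x ∈ P.powerset ×ˢ P.powerset, ∏ r ∈ P, h r (r ∈ x.1) (r ∈ x.2) =
      ∏ r ∈ P, ((h r True True + h r True False) + (h r False True + h r False False)) := by
  rw [Finset.sum_product, ← s14_sum_powerset_ite]
  apply Finset.sum_congr rfl
  intro S _
  have h1 : ∀ r, (if r ∈ S then h r True True + h r True False
      else h r False True + h r False False) = h r (r ∈ S) True + h r (r ∈ S) False := by
    intro r
    by_cases hr : r ∈ S <;> simp [hr]
  simp only [h1]
  rw [← s14_sum_powerset_ite]
  apply Finset.sum_congr rfl
  intro T _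
  apply Finset.prod_congr rfl
  intro r _
  by_cases hr : r ∈ T <;> simp [hr]

/-- local Fourier coefficients, with weights -/
def s14_B (r t : F2[X]) (p q : Prop) : ℝ :=
  if p then
    (if q then s14_a r * s14_b r *
        ((if t = 0 then 1 else 0) - 1 - s14_E (s14_q t r))
     else s14_a r * (s14_E (s14_q t r) - (if t = 0 then 1 else 0)))
  else
    (if q then s14_b r * (1 - (if t = 0 then 1 else 0))
     else (if t = 0 then 1 else 0))

lemma s14_local {r : F2[X]} (hr : Irreducible r) (f : F2[X]) (p q : Prop) :
    (if p then s14_a r * s14_c r (f + 1) else 1) * (if q then s14_b r * s14_c r f else 1) =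
      ∑ t ∈ GN r.natDegree, s14_B r t p q * s14_E (s14_q t r * algebraMap F2[X] (RatFunc F2) f) := by
  have h0 : (0 : F2[X]) ∈ GN r.natDegree := by rw [s14_mem_GN]; simp
  have hA := s14_full hr.ne_zero f
  have hA1 := s14_full hr.ne_zero (f + 1)
  have hsplit : ∀ t, s14_E (s14_q t r * algebraMap F2[X] (RatFunc F2) (f + 1)) =
      s14_E (s14_q t r) * s14_E (s14_q t r * algebraMap F2[X] (RatFunc F2) f) := by
    intro t
    rw [map_add, map_one, mul_add, mul_one, s14_E_add, mul_comm]
  simp only [hsplit] at hA1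
  have hD : ∑ t ∈ GN r.natDegree, (if t = 0 then (1 : ℝ) else 0) * s14_E (s14_q t r * algebraMap F2[X] (RatFunc F2) f) = 1 := by
    rw [Finset.sum_eq_single 0]
    · simp [s14_q, s14_E_zero]
    · intro b _ hb; simp [hb]
    · intro h; exact absurd h0 h
  have hnot : ¬ (r ∣ f ∧ r ∣ f + 1) := by
    rintro ⟨h1, h2⟩
    exact hr.not_isUnit (isUnit_of_dvd_one ((dvd_add_right h1).mp h2))
  unfold s14_B
  by_cases hp : p <;> by_cases hq : q <;> simp only [hp, hq, if_true, if_false]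
  · have : ∀ t, s14_a r * s14_b r * ((if t = 0 then (1 : ℝ) else 0) - 1 - s14_E (s14_q t r)) *
        s14_E (s14_q t r * algebraMap F2[X] (RatFunc F2) f) = s14_a r * s14_b r *
        ((if t = 0 then (1 : ℝ) else 0) * s14_E (s14_q t r * algebraMap F2[X] (RatFunc F2) f) - s14_E (s14_q t r * algebraMap F2[X] (RatFunc F2) f)
          - s14_E (s14_q t r) * s14_E (s14_q t r * algebraMap F2[X] (RatFunc F2) f)) := by
      intro t; ring
    simp only [this]
    rw [← Finset.mul_sum, Finset.sum_sub_distrib, Finset.sum_sub_distrib, hD, hA, hA1]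
    unfold s14_c
    by_cases h1 : r ∣ f
    · have h2 : ¬ r ∣ f + 1 := fun h => hnot ⟨h1, h⟩
      simp only [h1, h2, if_true, if_false]; ring
    · simp only [h1, if_false]; ring
  · have : ∀ t, s14_a r * (s14_E (s14_q t r) - (if t = 0 then (1 : ℝ) else 0)) *
        s14_E (s14_q t r * algebraMap F2[X] (RatFunc F2) f) = s14_a r *
        (s14_E (s14_q t r) * s14_E (s14_q t r * algebraMap F2[X] (RatFunc F2) f) -
          (if t = 0 then (1 : ℝ) else 0) * s14_E (s14_q t r * algebraMap F2[X] (RatFunc F2) f)) := by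
      intro t; ring
    simp only [this]
    rw [← Finset.mul_sum, Finset.sum_sub_distrib, hD, hA1]
    unfold s14_c
    ring
  · have : ∀ t, s14_b r * (1 - (if t = 0 then (1 : ℝ) else 0)) *
        s14_E (s14_q t r * algebraMap F2[X] (RatFunc F2) f) = s14_b r *
        (s14_E (s14_q t r * algebraMap F2[X] (RatFunc F2) f) -
          (if t = 0 then (1 : ℝ) else 0) * s14_E (s14_q t r * algebraMap F2[X] (RatFunc F2) f)) := by
      intro t; ring
    simp only [this]
    rw [← Finset.mul_sum, Finset.sum_sub_distrib, hD, hA]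
    unfold s14_c
    ring
  · rw [hD]; ring

/-- the weighted local factor -/
def s14_W (Y : F2[X] → ℝ) (r t : F2[X]) (p q : Prop) : ℝ :=
  |s14_B r t p q| * (if p ∨ q then Y r else 1)

/-- The primes below `R`. -/
def s14_P (R : ℕ) : Finset F2[X] := (GN R).filter (fun r => Irreducible r)

lemma s14_P_irr {R : ℕ} {r : F2[X]} (h : r ∈ s14_P R) : Irreducible r :=
  (Finset.mem_filter.mp h).2

/-- good pairs of sets of primes -/
def s14_good (R Q : ℕ) (x : Finset F2[X] × Finset F2[X]) : Prop :=
  (∑ r ∈ x.1, r.natDegree) < R ∧ (∑ r ∈ x.2, r.natDegree) < Q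

lemma s14_prod_sub (P S : Finset F2[X]) (hS : S ⊆ P) (v : F2[X] → ℝ) :
    ∏ r ∈ S, v r = ∏ r ∈ P, if r ∈ S then v r else 1 := by
  rw [Finset.prod_ite_mem, Finset.inter_eq_right.mpr hS]

def s14_term (R : ℕ) (x : Finset F2[X] × Finset F2[X]) (f : F2[X]) : ℝ :=
  ∏ r ∈ s14_P R, ∑ t ∈ GN r.natDegree, s14_B r t (r ∈ x.1) (r ∈ x.2) * s14_E (s14_q t r * algebraMap F2[X] (RatFunc F2) f)

lemma s14_term_eq (R : ℕ) (x : Finset F2[X] × Finset F2[X]) (f : F2[X])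
    (hx : x ∈ (s14_P R).powerset ×ˢ (s14_P R).powerset) :
    s14_term R x f =
      (∏ r ∈ x.1, (s14_a r * s14_c r (f + 1))) * ∏ r ∈ x.2, (s14_b r * s14_c r f) := by
  rw [Finset.mem_product, Finset.mem_powerset, Finset.mem_powerset] at hx
  rw [s14_prod_sub _ _ hx.1, s14_prod_sub _ _ hx.2, ← Finset.prod_mul_distrib]
  unfold s14_term
  apply Finset.prod_congr rfl
  intro r hr
  have := s14_local (s14_P_irr hr) f (r ∈ x.1) (r ∈ x.2)
  convert this.symm

lemma s14_Ft (R Q : ℕ) (hQ : Q ≤ R) (f : F2[X]) :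
    LambdaM R (f + 1) * HM Q f =
      ∑ x ∈ ((s14_P R).powerset ×ˢ (s14_P R).powerset).filter (s14_good R Q), s14_term R x f := by
  unfold LambdaM HM
  rw [s14_expand R R le_rfl (f + 1) alphaA s14_a
    (by intro s hs; simp [alphaA, mu, hs]) s14_alphaA,
    s14_expand R Q hQ f alphaB s14_b (by intro s hs; simp [alphaB, hs]) s14_alphaB,
    Finset.sum_mul_sum, ← Finset.sum_product']
  have : ((s14_P R).powerset ×ˢ (s14_P R).powerset).filter (s14_good R Q) =
      ((s14_P R).powerset.filter (fun S => (∑ r ∈ S, r.natDegree) < R)) ×ˢ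
      ((s14_P R).powerset.filter (fun S => (∑ r ∈ S, r.natDegree) < Q)) := by
    ext x
    simp only [Finset.mem_filter, Finset.mem_product, s14_good]
    tauto
  rw [this]
  apply Finset.sum_congr rfl
  intro x hx
  rw [s14_term_eq]
  simp only [Finset.mem_filter, Finset.mem_product] at hx ⊢
  exact ⟨hx.1.1, hx.2.1⟩

lemma s14_F (R : ℕ) (f : F2[X]) :
    LambdaTilde R (f + 1) * HTilde R f =
      ∑ x ∈ ((s14_P R).powerset ×ˢ (s14_P R).powerset), s14_term R x f := by
  unfold LambdaTilde HTilde
  have h1 : ∏ r ∈ (GN R).filter (fun r => Irreducible r), Lambda_r r (f + 1) =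
      ∏ r ∈ s14_P R, (1 + s14_a r * s14_c r (f + 1)) :=
    Finset.prod_congr rfl fun r hr => s14_Lambda_r (s14_P_irr hr) _
  have h2 : ∏ r ∈ (GN R).filter (fun r => Irreducible r), tauSq_r r f =
      ∏ r ∈ s14_P R, (1 + s14_b r * s14_c r f) :=
    Finset.prod_congr rfl fun r hr => s14_tauSq_r _ _
  rw [h1, h2, Finset.prod_one_add, Finset.prod_one_add, Finset.sum_mul_sum, ← Finset.sum_product']
  apply Finset.sum_congr rfl
  intro x hx
  rw [s14_term_eq _ _ _ hx]

/-- index set of the fractions -/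
def s14_I (R : ℕ) := (s14_P R).pi (fun r => GN r.natDegree)

def s14_l (R : ℕ) (p : ∀ r ∈ s14_P R, F2[X]) : RatFunc F2 :=
  ∑ x ∈ (s14_P R).attach, s14_q (p x.1 x.2) x.1

lemma s14_l_proper (R : ℕ) (p : ∀ r ∈ s14_P R, F2[X]) (hp : p ∈ s14_I R) :
    s14_Proper (s14_l R p) := by
  apply s14_Proper_sum
  intro x _
  have h := Finset.mem_pi.mp hp x.1 x.2
  rw [s14_mem_GN, ← degree_eq_natDegree (s14_P_irr x.2).ne_zero] at h
  exact s14_Proper_div (s14_P_irr x.2).ne_zero h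

lemma s14_l_inj (R : ℕ) (p p' : ∀ r ∈ s14_P R, F2[X]) (hp : p ∈ s14_I R) (hp' : p' ∈ s14_I R)
    (h : s14_l R p = s14_l R p') : p = p' := by
  funext r hr
  have hir := s14_P_irr hr
  -- the other primes
  set O : F2[X] := ∏ x ∈ (s14_P R).attach.erase ⟨r, hr⟩, x.1 with hO
  have hO0 : ∀ x ∈ (s14_P R).attach, x.1 ≠ 0 := fun x _ => (s14_P_irr x.2).ne_zero
  have key : ∀ p : (∀ r ∈ s14_P R, F2[X]), ∃ g : F2[X],
      s14_l R p * algebraMap F2[X] (RatFunc F2) r * algebraMap F2[X] (RatFunc F2) O = algebraMap F2[X] (RatFunc F2) (p r hr * O) + algebraMap F2[X] (RatFunc F2) (r * g) := by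
    intro p
    have h1 : s14_l R p = s14_q (p r hr) r +
        ∑ x ∈ (s14_P R).attach.erase ⟨r, hr⟩, s14_q (p x.1 x.2) x.1 := by
      unfold s14_l
      rw [← Finset.add_sum_erase _ _ (Finset.mem_attach _ ⟨r, hr⟩)]
    have h2 : ∀ x ∈ (s14_P R).attach.erase ⟨r, hr⟩, ∃ g : F2[X],
        s14_q (p x.1 x.2) x.1 * algebraMap F2[X] (RatFunc F2) O = algebraMap F2[X] (RatFunc F2) g := by
      intro x hx
      obtain ⟨g, hg⟩ : x.1 ∣ O := Finset.dvd_prod_of_mem (fun x : {x // x ∈ s14_P R} => x.1) hx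
      refine ⟨p x.1 x.2 * g, ?_⟩
      have := s14_AM_ne (s14_P_irr x.2).ne_zero
      rw [hg, map_mul, map_mul]
      unfold s14_q
      field_simp
    choose! g hg using h2
    refine ⟨∑ x ∈ (s14_P R).attach.erase ⟨r, hr⟩, g x, ?_⟩
    have h3 : algebraMap F2[X] (RatFunc F2) (∑ x ∈ (s14_P R).attach.erase ⟨r, hr⟩, g x) =
        (∑ x ∈ (s14_P R).attach.erase ⟨r, hr⟩, s14_q (p x.1 x.2) x.1) * algebraMap F2[X] (RatFunc F2) O := by
      rw [map_sum, Finset.sum_mul]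
      exact Finset.sum_congr rfl fun x hx => (hg x hx).symm
    rw [map_mul, map_mul, h3, h1]
    have h4 := s14_AM_ne hir.ne_zero
    have h5 : s14_q (p r hr) r * algebraMap F2[X] (RatFunc F2) r = algebraMap F2[X] (RatFunc F2) (p r hr) := by
      unfold s14_q; field_simp
    rw [← h5]; ring
  obtain ⟨g, hg⟩ := key p
  obtain ⟨g', hg'⟩ := key p'
  rw [h, hg', ← map_add, ← map_add] at hg
  have heq := IsFractionRing.injective F2[X] (RatFunc F2) hg
  have hdv : r ∣ (p r hr - p' r hr) * O := ⟨g' - g, by linear_combination -heq⟩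
  have hcop : IsCoprime r O := by
    apply IsCoprime.prod_right
    intro x hx
    refine s14_coprime_irr hir (s14_P_irr x.2) ?_
    intro hc
    exact (Finset.mem_erase.mp hx).1 (Subtype.ext hc.symm)
  have hdv2 := hcop.dvd_of_dvd_mul_right hdv
  have hz : p r hr - p' r hr = 0 := by
    apply eq_zero_of_dvd_of_degree_lt hdv2
    have h1 := Finset.mem_pi.mp hp r hr
    have h2 := Finset.mem_pi.mp hp' r hr
    rw [s14_mem_GN, ← degree_eq_natDegree hir.ne_zero] at h1 h2
    exact lt_of_le_of_lt (degree_sub_le _ _) (max_lt h1 h2)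
  exact sub_eq_zero.mp hz

/-- total extension of a tuple -/
def s14_ext (R : ℕ) (p : ∀ r ∈ s14_P R, F2[X]) (r : F2[X]) : F2[X] :=
  if h : r ∈ s14_P R then p r h else 0

lemma s14_term_expand (R : ℕ) (x : Finset F2[X] × Finset F2[X]) (f : F2[X]) :
    s14_term R x f = ∑ p ∈ s14_I R,
      (∏ r ∈ s14_P R, s14_B r (s14_ext R p r) (r ∈ x.1) (r ∈ x.2)) *
        s14_E (s14_l R p * algebraMap F2[X] (RatFunc F2) f) := by
  unfold s14_term
  rw [Finset.prod_sum]
  apply Finset.sum_congr rfl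
  intro p _
  rw [Finset.prod_mul_distrib]
  congr 1
  · rw [← Finset.prod_attach (s14_P R)]
    apply Finset.prod_congr rfl
    intro y _
    rw [s14_ext, dif_pos y.2]
  · unfold s14_l
    rw [Finset.sum_mul, s14_E_sum]

/-- the coefficients of the difference -/
def s14_coef (R Q : ℕ) (p : ∀ r ∈ s14_P R, F2[X]) : ℝ :=
  -∑ x ∈ ((s14_P R).powerset ×ˢ (s14_P R).powerset).filter (fun x => ¬ s14_good R Q x),
    ∏ r ∈ s14_P R, s14_B r (s14_ext R p r) (r ∈ x.1) (r ∈ x.2)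

lemma s14_diff (R Q : ℕ) (hQ : Q ≤ R) (f : F2[X]) :
    LambdaM R (f + 1) * HM Q f - LambdaTilde R (f + 1) * HTilde R f =
      ∑ p ∈ s14_I R, s14_coef R Q p * s14_E (s14_l R p * algebraMap F2[X] (RatFunc F2) f) := by
  rw [s14_Ft R Q hQ, s14_F, ← Finset.sum_filter_add_sum_filter_not
    ((s14_P R).powerset ×ˢ (s14_P R).powerset) (s14_good R Q)]
  unfold s14_coef
  simp only [s14_term_expand, neg_mul, Finset.sum_neg_distrib, Finset.sum_mul]
  rw [Finset.sum_comm (s := s14_I R)]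
  ring

lemma s14_coef_bound (R Q : ℕ) (hQ : Q ≤ R) (p : ∀ r ∈ s14_P R, F2[X]) (z : ℝ) (hz : 1 ≤ z) :
    |s14_coef R Q p| * z ^ Q ≤ ∏ r ∈ s14_P R,
      ((s14_W (fun r => z ^ r.natDegree) r (s14_ext R p r) True True +
        s14_W (fun r => z ^ r.natDegree) r (s14_ext R p r) True False) +
       (s14_W (fun r => z ^ r.natDegree) r (s14_ext R p r) False True +
        s14_W (fun r => z ^ r.natDegree) r (s14_ext R p r) False False)) := by
  rw [← s14_sum_powerset2 (s14_P R)
    (fun r a b => s14_W (fun r => z ^ r.natDegree) r (s14_ext R p r) a b)]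
  have hz0 : (0 : ℝ) ≤ z := by linarith
  have hW : ∀ r t a b, 0 ≤ s14_W (fun r => z ^ r.natDegree) r t a b := by
    intro r t a b
    unfold s14_W
    apply mul_nonneg (abs_nonneg _)
    split_ifs <;> positivity
  unfold s14_coef
  rw [abs_neg]
  calc _ ≤ (∑ x ∈ ((s14_P R).powerset ×ˢ (s14_P R).powerset).filter (fun x => ¬ s14_good R Q x),
        |∏ r ∈ s14_P R, s14_B r (s14_ext R p r) (r ∈ x.1) (r ∈ x.2)|) * z ^ Q := by
        gcongr
        exact Finset.abs_sum_le_sum_abs _ _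
    _ = ∑ x ∈ ((s14_P R).powerset ×ˢ (s14_P R).powerset).filter (fun x => ¬ s14_good R Q x),
        |∏ r ∈ s14_P R, s14_B r (s14_ext R p r) (r ∈ x.1) (r ∈ x.2)| * z ^ Q := by
        rw [Finset.sum_mul]
    _ ≤ ∑ x ∈ ((s14_P R).powerset ×ˢ (s14_P R).powerset).filter (fun x => ¬ s14_good R Q x),
        ∏ r ∈ s14_P R, s14_W (fun r => z ^ r.natDegree) r (s14_ext R p r) (r ∈ x.1) (r ∈ x.2) := by
        apply Finset.sum_le_sum
        intro x hx
        rw [Finset.mem_filter, Finset.mem_product, Finset.mem_powerset, Finset.mem_powerset] at hx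
        unfold s14_W
        rw [Finset.prod_mul_distrib, Finset.abs_prod]
        apply mul_le_mul_of_nonneg_left _ (Finset.prod_nonneg fun _ _ => abs_nonneg _)
        have h1 : ∏ r ∈ s14_P R, (if r ∈ x.1 ∨ r ∈ x.2 then z ^ r.natDegree else 1) =
            z ^ (∑ r ∈ x.1 ∪ x.2, r.natDegree) := by
          rw [← Finset.prod_pow_eq_pow_sum,
            s14_prod_sub (s14_P R) (x.1 ∪ x.2) (Finset.union_subset hx.1.1 hx.1.2)]
          simp only [Finset.mem_union]
        refine le_trans (pow_le_pow_right₀ hz (?_ : Q ≤ ∑ r ∈ x.1 ∪ x.2, r.natDegree)) (le_of_eq ?_)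
        swap
        · rw [← h1]
          apply Finset.prod_congr rfl
          intro r _
          congr
        have hb := hx.2
        unfold s14_good at hb
        have h2 : ∑ r ∈ x.1, r.natDegree ≤ ∑ r ∈ x.1 ∪ x.2, r.natDegree :=
          Finset.sum_le_sum_of_subset Finset.subset_union_left
        have h3 : ∑ r ∈ x.2, r.natDegree ≤ ∑ r ∈ x.1 ∪ x.2, r.natDegree :=
          Finset.sum_le_sum_of_subset Finset.subset_union_right
        omega
    _ ≤ _ := by
        apply Finset.sum_le_sum_of_subset_of_nonneg (Finset.filter_subset _ _)
        intro x _ _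
        exact Finset.prod_nonneg fun r _ => hW _ _ _ _

/-! ### Analytic estimates -/

lemma s14_local_bound (ρ : ℝ) (hρ0 : 0 < ρ) (hρ1 : ρ < 1) (D : ℕ) (hD : ρ ^ D < 1 / 11)
    {r : F2[X]} (hr : Irreducible r) (t : F2[X]) :
    (s14_W (fun r => (2 * ρ) ^ r.natDegree) r t True True +
      s14_W (fun r => (2 * ρ) ^ r.natDegree) r t True False) +
     (s14_W (fun r => (2 * ρ) ^ r.natDegree) r t False True +
      s14_W (fun r => (2 * ρ) ^ r.natDegree) r t False False) ≤
    1 + (11 * 2 ^ D) * (ρ / 2) ^ r.natDegree := by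
  have hd := s14_natDegree_pos hr
  set d := r.natDegree with hdd
  have hx2 : (2 : ℝ) ≤ 2 ^ d := by
    simpa using pow_le_pow_right₀ (by norm_num : (1 : ℝ) ≤ 2) hd
  have hu0 : 0 < ρ ^ d := pow_pos hρ0 d
  have hD1 : (1 : ℝ) ≤ 2 ^ D := one_le_pow₀ (by norm_num)
  have hux : (ρ / 2) ^ d = ρ ^ d / 2 ^ d := div_pow _ _ _
  have hcase : ρ ^ d ≤ 1 / 11 ∨ (2 : ℝ) ^ d ≤ 2 ^ D := by
    by_cases h : D ≤ d
    · left
      exact le_trans (pow_le_pow_of_le_one hρ0.le hρ1.le h) hD.le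
    · right
      exact pow_le_pow_right₀ (by norm_num) (by omega)
  have ha : |s14_a r| = 1 / ((2 : ℝ) ^ d - 1) := by
    unfold s14_a
    rw [abs_div, abs_neg, abs_one, abs_of_pos (by linarith)]
  have hb : |s14_b r| = 3 / ((2 : ℝ) ^ d + 3) := by
    unfold s14_b
    rw [abs_of_pos (by positivity)]
  rw [hux]
  simp only [s14_W, s14_B, if_true, if_false, or_true, or_false, abs_mul, ha, hb,
    mul_pow, ← hdd]
  generalize (2 : ℝ) ^ d = x at *
  generalize ρ ^ d = u at *
  generalize (2 : ℝ) ^ D = T at *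
  have hA : 1 / (x - 1) ≤ 2 / x := by
    rw [div_le_div_iff₀ (by linarith) (by linarith)]; linarith
  have hB : 3 / (x + 3) ≤ 3 / x := by
    apply div_le_div_of_nonneg_left <;> linarith
  have hA0 : 0 ≤ 1 / (x - 1) := by apply div_nonneg <;> linarith
  have hB0 : 0 ≤ 3 / (x + 3) := by apply div_nonneg <;> linarith
  have hx0 : 0 < x := by linarith
  by_cases ht : t = 0
  · subst ht
    simp only [s14_q, map_zero, zero_div, s14_E_zero, if_true]
    norm_num
    have h1 : 1 / (x - 1) * (3 / (x + 3)) * (x * u) ≤ 2 / x * (3 / x) * (x * u) := by gcongr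
    have h2 : 2 / x * (3 / x) * (x * u) = 6 * (u / x) := by field_simp; norm_num
    have h3 : 0 ≤ u / x := by positivity
    have h4 : 6 * (u / x) ≤ 11 * T * (u / x) := by gcongr; linarith
    simp only [one_div] at h1
    linarith
  · simp only [ht, if_false]
    have hE := s14_E_abs (s14_q t r)
    have h0 : |(0 : ℝ) - 1 - s14_E (s14_q t r)| ≤ 2 := by
      rcases s14_E_cases (s14_q t r) with h | h <;> rw [h] <;> norm_num
    simp only [sub_zero, hE, abs_one, abs_zero]
    have h1 : 1 / (x - 1) * (3 / (x + 3)) * |(0 : ℝ) - 1 - s14_E (s14_q t r)| * (x * u) ≤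
        1 * (3 / x) * 2 * (x * u) := by
      gcongr
      rw [div_le_one (by linarith)]; linarith
    have h2 : 1 / (x - 1) * 1 * (x * u) ≤ 2 / x * 1 * (x * u) := by gcongr
    have h3 : 3 / (x + 3) * 1 * (x * u) ≤ 3 / x * 1 * (x * u) := by gcongr
    have h4 : 1 * (3 / x) * 2 * (x * u) + 2 / x * 1 * (x * u) + 3 / x * 1 * (x * u) = 11 * u := by
      field_simp; ring
    have h5 : 11 * u ≤ 1 + 11 * T * (u / x) := by
      rcases hcase with h | h
      · have : 0 ≤ 11 * T * (u / x) := by positivity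
        linarith
      · have : u ≤ T * (u / x) := by
          rw [← mul_div_assoc, le_div_iff₀ hx0]
          nlinarith
        linarith
    linarith

lemma s14_sum_primes (ρ : ℝ) (hρ0 : 0 < ρ) (hρ1 : ρ < 1) (R : ℕ) :
    ∑ r ∈ s14_P R, (ρ / 2) ^ r.natDegree ≤ 2 / (1 - ρ) := by
  have hmaps : ∀ r ∈ s14_P R, r.natDegree ∈ Finset.range R := by
    intro r hr
    rw [Finset.mem_range]
    have h1 := (Finset.mem_filter.mp hr).1
    rw [s14_mem_GN, degree_eq_natDegree (s14_P_irr hr).ne_zero] at h1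
    exact_mod_cast h1
  rw [← Finset.sum_fiberwise_of_maps_to hmaps]
  calc _ ≤ ∑ d ∈ Finset.range R, 2 * ρ ^ d := by
        apply Finset.sum_le_sum
        intro d _
        have h1 : ∑ r ∈ (s14_P R).filter (fun r => r.natDegree = d), (ρ / 2) ^ r.natDegree =
            ((s14_P R).filter (fun r => r.natDegree = d)).card * (ρ / 2) ^ d := by
          rw [← nsmul_eq_mul, ← Finset.sum_const]
          apply Finset.sum_congr rfl
          intro r hr
          rw [(Finset.mem_filter.mp hr).2]
        rw [h1]
        have h2 : ((s14_P R).filter (fun r => r.natDegree = d)).card ≤ 2 ^ (d + 1) := by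
          rw [← s14_GN_card]
          apply Finset.card_le_card
          intro r hr
          rw [Finset.mem_filter] at hr
          rw [s14_mem_GN, degree_eq_natDegree (s14_P_irr hr.1).ne_zero, hr.2]
          exact_mod_cast Nat.lt_succ_self d
        have h3 : (((s14_P R).filter (fun r => r.natDegree = d)).card : ℝ) ≤ 2 ^ (d + 1) := by
          exact_mod_cast h2
        calc _ ≤ (2 : ℝ) ^ (d + 1) * (ρ / 2) ^ d := by gcongr
          _ = 2 * ρ ^ d := by rw [div_pow, pow_succ]; field_simp
    _ = 2 * ∑ d ∈ Finset.range R, ρ ^ d := by rw [Finset.mul_sum]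
    _ ≤ 2 * (1 / (1 - ρ)) := by
        gcongr
        have h1 := geom_sum_mul ρ R
        rw [le_div_iff₀ (by linarith)]
        have h2 : 0 < ρ ^ R := pow_pos hρ0 R
        linarith
    _ = _ := by ring

lemma s14_coef_final (ρ : ℝ) (hρ0 : 1 / 2 ≤ ρ) (hρ1 : ρ < 1) :
    ∃ C0 : ℝ, 0 < C0 ∧ ∀ (R Q : ℕ), Q ≤ R → ∀ p : (∀ r ∈ s14_P R, F2[X]),
      |s14_coef R Q p| * (2 * ρ) ^ Q ≤ C0 := by
  have hρ : 0 < ρ := by linarith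
  obtain ⟨D, hD⟩ := exists_pow_lt_of_lt_one (by norm_num : (0 : ℝ) < 1 / 11) hρ1
  refine ⟨Real.exp (11 * 2 ^ D * (2 / (1 - ρ))), Real.exp_pos _, ?_⟩
  intro R Q hQ p
  refine le_trans (s14_coef_bound R Q hQ p (2 * ρ) (by linarith)) ?_
  calc _ ≤ ∏ r ∈ s14_P R, Real.exp ((11 * 2 ^ D) * (ρ / 2) ^ r.natDegree) := by
        apply Finset.prod_le_prod
        · intro r _
          unfold s14_W
          positivity
        · intro r hr
          refine le_trans (s14_local_bound ρ hρ hρ1 D hD (s14_P_irr hr) _) ?_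
          rw [add_comm]
          exact Real.add_one_le_exp _
    _ = Real.exp (11 * 2 ^ D * ∑ r ∈ s14_P R, (ρ / 2) ^ r.natDegree) := by
        rw [← Real.exp_sum, Finset.mul_sum]
    _ ≤ _ := by
        apply Real.exp_le_exp.mpr
        gcongr
        exact s14_sum_primes ρ hρ hρ1 R

/-- Every difference of Fourier coefficients is one of the `s14_coef`, or zero. -/
lemma s14_unique (R Q : ℕ) (hQ : Q ≤ R) (βt β : RatFunc F2 → ℝ)
    (ht : IsFourierCoeffs (fun f => LambdaM R (f + 1) * HM Q f) βt)
    (hβ : IsFourierCoeffs (fun f => LambdaTilde R (f + 1) * HTilde R f) β) (l : RatFunc F2) :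
    βt l - β l = 0 ∨ ∃ p, βt l - β l = s14_coef R Q p := by
  obtain ⟨hf1, hp1, he1⟩ := ht
  obtain ⟨hf2, hp2, he2⟩ := hβ
  set s : Finset (RatFunc F2) := hf1.toFinset ∪ hf2.toFinset ∪ (s14_I R).image (s14_l R) with hs
  have hprop : ∀ l ∈ s, s14_Proper l := by
    intro l hl
    rw [hs, Finset.mem_union, Finset.mem_union, Set.Finite.mem_toFinset, Set.Finite.mem_toFinset,
      Finset.mem_image] at hl
    rcases hl with (h | h) | ⟨p, hp, rfl⟩
    · exact s14_Proper_of_num (hp1 l h)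
    · exact s14_Proper_of_num (hp2 l h)
    · exact s14_l_proper R p hp
  have hE : ∀ (l : RatFunc F2) (f : F2[X]), eKr (ratToK l * polyToK f) = s14_E (l * algebraMap F2[X] (RatFunc F2) f) := by
    intro l f
    rw [s14_E, map_mul, s14_io_poly, s14_io_ratToK]
  simp only [hE] at he1 he2
  have hfin : ∀ (c : RatFunc F2 → ℝ), Function.support c ⊆ s → ∀ f : F2[X],
      ∑ᶠ l, c l * s14_E (l * algebraMap F2[X] (RatFunc F2) f) = ∑ l ∈ s, c l * s14_E (l * algebraMap F2[X] (RatFunc F2) f) := by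
    intro c hc f
    apply finsum_eq_sum_of_support_subset
    intro l hl
    apply hc
    rw [Function.mem_support] at *
    exact left_ne_zero_of_mul hl
  have hs1 : Function.support βt ⊆ s := by
    intro l hl
    simp only [hs, Finset.coe_union, Set.mem_union, Finset.mem_coe, Set.Finite.mem_toFinset]
    exact Or.inl (Or.inl hl)
  have hs2 : Function.support β ⊆ s := by
    intro l hl
    simp only [hs, Finset.coe_union, Set.mem_union, Finset.mem_coe, Set.Finite.mem_toFinset]
    exact Or.inl (Or.inr hl)
  by_cases hl : l ∈ s
  swap
  · left
    have h1 : βt l = 0 := by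
      by_contra hc; exact hl (hs1 hc)
    have h2 : β l = 0 := by
      by_contra hc; exact hl (hs2 hc)
    rw [h1, h2, sub_zero]
  have hind := s14_indep s hprop
    (fun l => βt l - β l - ∑ p ∈ (s14_I R).filter (fun p => s14_l R p = l), s14_coef R Q p) ?_ l hl
  · rw [sub_eq_zero] at hind
    rw [hind]
    by_cases hex : ∃ p ∈ s14_I R, s14_l R p = l
    · obtain ⟨p, hp, hpl⟩ := hex
      right
      refine ⟨p, ?_⟩
      have : (s14_I R).filter (fun p => s14_l R p = l) = {p} := by
        ext p'
        rw [Finset.mem_filter, Finset.mem_singleton]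
        constructor
        · rintro ⟨h1, h2⟩
          exact s14_l_inj R p' p h1 hp (h2.trans hpl.symm)
        · rintro rfl; exact ⟨hp, hpl⟩
      rw [this, Finset.sum_singleton]
    · left
      apply Finset.sum_eq_zero
      intro p hp
      rw [Finset.mem_filter] at hp
      exact absurd ⟨p, hp.1, hp.2⟩ hex
  · intro f
    have h1 := he1 f
    have h2 := he2 f
    rw [hfin βt hs1] at h1
    rw [hfin β hs2] at h2
    have h3 := s14_diff R Q hQ f
    rw [h1, h2] at h3
    have hmaps : ∀ p ∈ s14_I R, s14_l R p ∈ s := by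
      intro p hp
      rw [hs]
      exact Finset.mem_union_right _ (Finset.mem_image_of_mem _ hp)
    rw [← Finset.sum_fiberwise_of_maps_to hmaps] at h3
    simp only [sub_mul, Finset.sum_sub_distrib]
    rw [h3, sub_eq_zero]
    apply Finset.sum_congr rfl
    intro l _
    rw [Finset.sum_mul]
    apply Finset.sum_congr rfl
    intro p hp
    rw [(Finset.mem_filter.mp hp).2]

/-- With `K = (1/8−ε)N`, `R = N/4`, `Q = N/8`: for sufficiently large `N` (given any
implied constant `C` in the `O_ε(log N)` term), if `λ` has denominator of degree
`≤ (1+ε)K + C·log N`, then `|β^trunc(λ) − β(λ)| ≤ (1/5)·2^{−K}`, where `β^trunc` and `β`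
are the Fourier coefficients of `f ↦ Λ_R(f+1)H_Q(f)` and `f ↦ ˜Λ_R(f+1)˜H_R(f)`. -/
theorem statement_14 (ε : ℝ) (hε : 0 < ε) (C : ℝ) :
    ∃ N₀ : ℕ, ∀ N : ℕ, N₀ ≤ N →
      ∀ βt β : RatFunc F2 → ℝ,
        IsFourierCoeffs (fun f => LambdaM (N / 4) (f + 1) * HM (N / 8) f) βt →
        IsFourierCoeffs (fun f => LambdaTilde (N / 4) (f + 1) * HTilde (N / 4) f) β →
        ∀ l : RatFunc F2,
          ((l.denom).natDegree : ℝ) ≤ (1 + ε) * ((1 / 8 - ε) * (N : ℝ)) + C * Real.log (N : ℝ) →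
          |βt l - β l| ≤ (1 / 5) * (2 : ℝ) ^ (-((1 / 8 - ε) * (N : ℝ))) := by
  set δ : ℝ := min (4 * ε) (1 / 2) with hδ
  have hδ0 : 0 < δ := lt_min (by linarith) (by norm_num)
  have hδ1 : δ ≤ 1 / 2 := min_le_right _ _
  have hδ2 : δ ≤ 4 * ε := min_le_left _ _
  set ρ : ℝ := (2 : ℝ) ^ (-δ) with hρ
  have hρ1 : ρ < 1 := Real.rpow_lt_one_of_one_lt_of_neg (by norm_num) (by linarith)
  have hρ0 : 1 / 2 ≤ ρ := by
    have : (2 : ℝ) ^ (-1 : ℝ) ≤ 2 ^ (-δ) :=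
      Real.rpow_le_rpow_of_exponent_le (by norm_num) (by linarith)
    rw [Real.rpow_neg_one] at this
    rw [hρ]; linarith
  have hz : 2 * ρ = (2 : ℝ) ^ (1 - δ) := by
    rw [hρ, sub_eq_add_neg, Real.rpow_add (by norm_num), Real.rpow_one]
  obtain ⟨C0, hC0, hbound⟩ := s14_coef_final ρ hρ0 hρ1
  have hgt : (1 : ℝ) < 2 ^ (ε / 2) := Real.one_lt_rpow (by norm_num) (by linarith)
  obtain ⟨N₀, hN₀⟩ := pow_unbounded_of_one_lt (10 * C0) hgt
  refine ⟨N₀, ?_⟩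
  intro N hN βt β hβt hβ l _
  have hpos : (0 : ℝ) < (1 / 5) * (2 : ℝ) ^ (-((1 / 8 - ε) * (N : ℝ))) := by positivity
  rcases s14_unique (N / 4) (N / 8) (by omega) βt β hβt hβ l with h | ⟨p, h⟩
  · rw [h, abs_zero]; exact hpos.le
  rw [h]
  have hb := hbound (N / 4) (N / 8) (by omega) p
  rw [hz, ← Real.rpow_natCast, ← Real.rpow_mul (by norm_num)] at hb
  have hQ : (N : ℝ) / 8 - 1 ≤ ((N / 8 : ℕ) : ℝ) := by
    have h1 : N ≤ 8 * (N / 8) + 8 := by omega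
    have h2 : (N : ℝ) ≤ 8 * ((N / 8 : ℕ) : ℝ) + 8 := by exact_mod_cast h1
    linarith
  have hNpos : (0 : ℝ) ≤ (N : ℝ) := Nat.cast_nonneg N
  have hexp : ε / 2 * N + ((1 / 8 - ε) * (N : ℝ)) - 1 ≤ (1 - δ) * ((N / 8 : ℕ) : ℝ) := by
    have h1 : (1 - δ) * ((N : ℝ) / 8 - 1) ≤ (1 - δ) * ((N / 8 : ℕ) : ℝ) :=
      mul_le_mul_of_nonneg_left hQ (by linarith)
    have h2 : δ * (N : ℝ) ≤ 4 * ε * N := mul_le_mul_of_nonneg_right hδ2 hNpos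
    nlinarith
  have hle : (2 : ℝ) ^ (ε / 2 * N + ((1 / 8 - ε) * (N : ℝ)) - 1) ≤
      2 ^ ((1 - δ) * ((N / 8 : ℕ) : ℝ)) :=
    Real.rpow_le_rpow_of_exponent_le (by norm_num) hexp
  rw [Real.rpow_sub (by norm_num), Real.rpow_add (by norm_num), Real.rpow_one,
    Real.rpow_mul (by norm_num), Real.rpow_natCast] at hle
  have hbig : 10 * C0 ≤ ((2 : ℝ) ^ (ε / 2)) ^ N :=
    hN₀.le.trans (pow_le_pow_right₀ hgt.le hN)
  rw [Real.rpow_neg (by norm_num)]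
  have hY : (0 : ℝ) < 2 ^ ((1 / 8 - ε) * (N : ℝ)) := by positivity
  generalize (2 : ℝ) ^ ((1 / 8 - ε) * (N : ℝ)) = Y at *
  generalize ((2 : ℝ) ^ (ε / 2)) ^ N = Z at *
  generalize (2 : ℝ) ^ ((1 - δ) * ((N / 8 : ℕ) : ℝ)) = V at *
  generalize |s14_coef (N / 4) (N / 8) p| = c at *
  rw [← div_eq_mul_inv, le_div_iff₀ hY]
  by_contra hcon
  push Not at hcon
  have hc0 : 0 < c := by
    by_contra hc
    push Not at hc
    nlinarith
  have h1 : c * (Z * Y / 2) ≤ C0 := (mul_le_mul_of_nonneg_left hle hc0.le).trans hb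
  have h2 : 1 / 5 * Z < c * Y * Z := mul_lt_mul_of_pos_right hcon (by linarith)
  nlinarith
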